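/- arXiv:1011.5201 — 2 statements merged into one kernel-verified Lean document; each statement's English description precedes it below -/
import Mathlib

section
/- (Remark 5.2; Donkin's theorem.) The ideal of free relations for matrix GL(n)-invariants is zero for an arbitrary characteristic: if f ∈ N_σ satisfies Ψ_n(f) = 0 for every n ≥ 1, then f = 0. -/
/-! Statement 2: (Remark 5.2; Donkin's theorem.) The ideal of free relations for
matrix `GL(n)`-invariants is zero in arbitrary characteristic. -/

open scoped BigOperators
open Matrix

/-- The `m`-th power `e^m` of a word `e` (concatenation of `m` copies). -/
def wpow {A : Type*} (e : List A) (m : ℕ) : List A := (List.replicate m e).flatten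

/-- A word is primitive if it is nonempty and is not a power `e^m` with `m ≥ 2`. -/
def WPrimitive {A : Type*} (w : List A) : Prop :=
  w ≠ [] ∧ ∀ (e : List A) (m : ℕ), 2 ≤ m → w ≠ wpow e m

/-- The set `N` of primitive words in the letters `x_1, …, x_d`. -/
def PrimWord (d : ℕ) := {w : List (Fin d) // WPrimitive w}

/-- Cyclic-equivalence classes of primitive words. -/
def WCls (d : ℕ) := Quot (fun a b : PrimWord d => List.IsRotated a.1 b.1)

/-- The polynomial algebra `N_σ` on indeterminates `σ_t(ā)`, `t ≥ 1`,
`ā` a cyclic-equivalence class of primitive words. -/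
abbrev Nsigma (F : Type*) [CommSemiring F] (d : ℕ) := MvPolynomial (ℕ+ × WCls d) F

/-- `σ_t(A)`: the coefficient of `λ^{n-t}` in `det(A + λE)`. -/
noncomputable def msigma {R : Type*} [CommRing R] {ι : Type*} [Fintype ι] [DecidableEq ι]
    (t : ℕ) (A : Matrix ι ι R) : R :=
  ((A.map Polynomial.C + (Polynomial.X : Polynomial R) • 1).det).coeff (Fintype.card ι - t)

/-- The coordinate ring `R_n = F[x_{ij}(k)]`. -/
abbrev Rmat (F : Type*) [CommSemiring F] (n d : ℕ) := MvPolynomial (Fin n × Fin n × Fin d) F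

/-- The generic `n × n` matrix `X_k`. -/
noncomputable def genX (F : Type*) [CommSemiring F] (n d : ℕ) (k : Fin d) :
    Matrix (Fin n) (Fin n) (Rmat F n d) :=
  Matrix.of fun i j => MvPolynomial.X (i, j, k)

/-- The matrix `X_a = X_{k_1} ⋯ X_{k_r}` of a word `a = x_{k_1} ⋯ x_{k_r}`. -/
noncomputable def glWordMat (F : Type*) [CommSemiring F] (n d : ℕ) (w : List (Fin d)) :
    Matrix (Fin n) (Fin n) (Rmat F n d) :=
  (w.map (genX F n d)).prod

/-- The evaluation homomorphism `Ψ_n : N_σ → R_n`, sending `σ_t(ā)` to `σ_t(X_a)` if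
`t ≤ n` and to `0` otherwise (it does not depend on the representative of `ā`). -/
noncomputable def PsiGL (F : Type*) [Field F] (n d : ℕ) : Nsigma F d →ₐ[F] Rmat F n d :=
  MvPolynomial.aeval fun v : ℕ+ × WCls d =>
    if (v.1 : ℕ) ≤ n then msigma v.1 (glWordMat F n d (Quot.out v.2).1) else 0

theorem h_wpow_succ {A : Type*} (e : List A) (m : ℕ) : wpow e (m+1) = e ++ wpow e m := by
  simp [wpow, List.replicate_succ]

theorem h_wpow_length {A : Type*} (e : List A) (m : ℕ) : (wpow e m).length = m * e.length := by
  simp [wpow]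

theorem h_wpow_get {A : Type*} (e : List A) (m : ℕ) (l : ℕ) (hl : l < m * e.length) :
    (wpow e m)[l]? = e[l % e.length]? := by
  induction m generalizing l with
  | zero => simp at hl
  | succ m ih =>
    rw [h_wpow_succ]
    by_cases h : l < e.length
    · rw [List.getElem?_append_left h, Nat.mod_eq_of_lt h]
    · push Not at h
      rw [List.getElem?_append_right h, ih _ (by rw [Nat.succ_mul] at hl; omega),
        ← Nat.mod_eq_sub_mod h]

theorem h_per_mul {B : Type*} (g : ℕ → B) (p : ℕ) (hp : ∀ l, g (l + p) = g l) (k l : ℕ) :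
    g (l + p * k) = g l := by
  induction k with
  | zero => simp
  | succ k ih => rw [Nat.mul_succ, ← add_assoc, hp, ih]

theorem h_per_gcd {B : Type*} (g : ℕ → B) (p q : ℕ) : (∀ l, g (l + p) = g l) →
    (∀ l, g (l + q) = g l) → ∀ l, g (l + Nat.gcd p q) = g l := by
  induction p, q using Nat.gcd.induction with
  | H0 n => intro _ h; simpa using h
  | H1 m n hm ih =>
    intro h1 h2
    rw [Nat.gcd_rec]
    apply ih _ h1
    intro l
    rw [← h_per_mul g m h1 (n / m) (l + n % m), add_assoc, Nat.mod_add_div, h2]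

/-- primitive words have no smaller cyclic period -/
theorem h_prim_period {A : Type*} (a : List A) (ha : WPrimitive a) (p : ℕ)
    (hp : ∀ l, a[(l + p) % a.length]? = a[l % a.length]?) : a.length ∣ p := by
  have hpos : 0 < a.length := List.length_pos_iff.mpr ha.1
  have hg := h_per_gcd (fun l => a[l % a.length]?) p a.length hp (by intro l; simp)
  set h := Nat.gcd p a.length with hh
  have hd : h ∣ a.length := Nat.gcd_dvd_right _ _
  have hh0 : 0 < h := Nat.gcd_pos_of_pos_right _ hpos
  have hle : h ≤ a.length := Nat.le_of_dvd hpos hd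
  obtain ⟨m, hm⟩ := hd
  have key : a = wpow (a.take h) m := by
    apply List.ext_getElem?
    intro l
    have hlen : (a.take h).length = h := by simp [hle]
    by_cases hl : l < a.length
    · rw [h_wpow_get _ _ _ (by rw [hlen]; rwa [mul_comm, ← hm]), hlen,
        List.getElem?_take_of_lt (Nat.mod_lt _ hh0)]
      have := h_per_mul (fun l => a[l % a.length]?) h hg (l / h) (l % h)
      simp only [Nat.mod_add_div] at this
      rw [Nat.mod_eq_of_lt hl] at this
      rw [this, Nat.mod_eq_of_lt (lt_of_lt_of_le (Nat.mod_lt _ hh0) hle)]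
    · rw [List.getElem?_eq_none (by omega), List.getElem?_eq_none]
      rw [h_wpow_length, hlen, mul_comm, ← hm]; omega
  have hm2 : ¬ 2 ≤ m := fun h2 => ha.2 _ m h2 key
  have : m = 1 := by
    rcases m with _ | _ | m
    · simp only [mul_zero] at hm; omega
    · rfl
    · omega
  rw [this, mul_one] at hm
  rw [hm]; exact Nat.gcd_dvd_left _ _

theorem h_prim_rot {A : Type*} (a b : List A) (ha : WPrimitive a) (hb : WPrimitive b) (i : ℕ)
    (h : ∀ l, l < a.length * b.length → b[l % b.length]? = a[(i + l) % a.length]?) :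
    List.IsRotated a b := by
  have hpa : 0 < a.length := List.length_pos_iff.mpr ha.1
  have hpb : 0 < b.length := List.length_pos_iff.mpr hb.1
  have h' : ∀ l, b[l % b.length]? = a[(i + l) % a.length]? := by
    intro l
    have := h (l % (a.length * b.length)) (Nat.mod_lt _ (Nat.mul_pos hpa hpb))
    rw [Nat.mod_mul_left_mod] at this
    rw [this, Nat.add_mod, Nat.mod_mul_right_mod, ← Nat.add_mod]
  have h1 : b.length ∣ a.length := by
    apply h_prim_period b hb
    intro l
    rw [h', h', ← add_assoc, Nat.add_mod_right]
  have h2 : a.length ∣ b.length := by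
    apply h_prim_period a ha
    have : ∀ l, a[(i + l + b.length) % a.length]? = a[(i + l) % a.length]? := by
      intro l
      rw [add_assoc, ← h', ← h', Nat.add_mod_right]
    intro l
    have h3 := this (l + i * (a.length - 1))
    have e : i + (l + i * (a.length - 1)) = l + a.length * i := by
      obtain ⟨r, hr⟩ : ∃ r, a.length = r + 1 := ⟨a.length - 1, by omega⟩
      rw [hr]; simp; ring
    rw [e, Nat.add_mul_mod_self_left, add_right_comm, Nat.add_mul_mod_self_left] at h3
    exact h3
  have e : a.length = b.length := Nat.dvd_antisymm h2 h1
  refine ⟨i, ?_⟩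
  apply List.ext_getElem?
  intro l
  by_cases hl : l < a.length
  · rw [List.getElem?_rotate hl]
    have := h' l
    rw [Nat.mod_eq_of_lt (by omega)] at this
    rw [this, add_comm]
  · rw [List.getElem?_eq_none (by simp; omega), List.getElem?_eq_none (by omega)]

/-- The cyclic quiver representation attached to a word, with one weighted arrow. -/
def cycM {K : Type*} [Field K] {d : ℕ} (a : List (Fin d)) (L : ℕ) (y : K) (k : Fin d) :
    Matrix (Fin L) (Fin L) K :=
  Matrix.of fun i j => if a[i.val]? = some k ∧ j.val = (i.val + 1) % a.length then
    (if i.val = 0 then y else 1) else 0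

theorem cycM_ne {K : Type*} [Field K] {d : ℕ} (a : List (Fin d)) (L : ℕ) (y : K)
    (w : List (Fin d)) (i j : Fin L) (h : (w.map (cycM a L y)).prod i j ≠ 0) :
    (∀ l < w.length, i.val < a.length ∧ w[l]? = a[(i.val + l) % a.length]?) ∧
      (i.val < a.length → j.val = (i.val + w.length) % a.length) := by
  induction w generalizing i with
  | nil =>
    simp only [List.map_nil, List.prod_nil] at h
    have : i = j := by
      by_contra hne
      exact h (Matrix.one_apply_ne hne)
    subst this
    refine ⟨by simp, fun hi => ?_⟩
    simp [Nat.mod_eq_of_lt hi]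
  | cons k w ih =>
    simp only [List.map_cons, List.prod_cons] at h
    rw [Matrix.mul_apply] at h
    obtain ⟨j', -, hj'⟩ := Finset.exists_ne_zero_of_sum_ne_zero h
    have h1 := left_ne_zero_of_mul hj'
    have h2 := right_ne_zero_of_mul hj'
    obtain ⟨ih1, ih2⟩ := ih j' h2
    simp only [cycM, Matrix.of_apply, ne_eq, ite_eq_right_iff, not_forall] at h1
    obtain ⟨⟨ha, hj⟩, -⟩ := h1
    have hi : i.val < a.length := by
      by_contra hc
      rw [List.getElem?_eq_none (by omega)] at ha
      simp at ha
    have hj2 : j'.val < a.length := by rw [hj]; exact Nat.mod_lt _ (by omega)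
    refine ⟨?_, fun _ => ?_⟩
    · intro l hl
      refine ⟨hi, ?_⟩
      rcases l with _ | l
      · simp [Nat.mod_eq_of_lt hi, ha]
      · have := (ih1 l (by simpa using hl)).2
        rw [hj, Nat.mod_add_mod] at this
        simp only [List.getElem?_cons_succ]
        rw [this]; congr 2; ring
    · rw [ih2 hj2, hj, Nat.mod_add_mod, List.length_cons]
      congr 1; ring

theorem cycM_eq {K : Type*} [Field K] {d : ℕ} (a : List (Fin d)) (L : ℕ) (hL : a.length ≤ L)
    (y : K) (w : List (Fin d)) (i j : Fin L) (hi : i.val < a.length)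
    (hw : ∀ l < w.length, w[l]? = a[(i.val + l) % a.length]?)
    (hj : j.val = (i.val + w.length) % a.length) :
    (w.map (cycM a L y)).prod i j =
      ∏ l ∈ Finset.range w.length, (if (i.val + l) % a.length = 0 then y else 1) := by
  induction w generalizing i with
  | nil =>
    have : i = j := by
      apply Fin.ext
      rw [hj]; simp [Nat.mod_eq_of_lt hi]
    subst this
    simp
  | cons k w ih =>
    have hpos : 0 < a.length := by omega
    have hlt := Nat.mod_lt (i.val + 1) hpos
    let j' : Fin L := ⟨(i.val + 1) % a.length, by omega⟩
    simp only [List.map_cons, List.prod_cons]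
    rw [Matrix.mul_apply, Finset.sum_eq_single j']
    · rw [ih j' hlt]
      · rw [List.length_cons, Finset.prod_range_succ', mul_comm]
        congr 1
        · apply Finset.prod_congr rfl
          intro l _
          simp only [j', Nat.mod_add_mod]
          rw [show i.val + 1 + l = i.val + (l + 1) by ring]
        · have := hw 0 (by simp)
          simp only [List.getElem?_cons_zero, add_zero, Nat.mod_eq_of_lt hi] at this
          simp [cycM, j', ← this, Nat.mod_eq_of_lt hi]
      · intro l hl
        have := hw (l + 1) (by simpa using hl)
        simp only [List.getElem?_cons_succ] at this
        simp only [j', Nat.mod_add_mod]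
        rw [this]; congr 2; ring
      · rw [hj]; simp only [j', Nat.mod_add_mod, List.length_cons]
        congr 1; ring
    · intro b _ hb
      have : ¬ (b.val = (i.val + 1) % a.length) := fun h => hb (Fin.ext h)
      simp [cycM, this]
    · simp

theorem map_wpow_prod {M : Type*} [Monoid M] {A : Type*} (φ : A → M) (e : List A) (m : ℕ) :
    ((wpow e m).map φ).prod = ((e.map φ).prod) ^ m := by
  induction m with
  | zero => simp [wpow]
  | succ m ih => rw [h_wpow_succ, List.map_append, List.prod_append, ih, pow_succ']

theorem cycM_nilp {K : Type*} [Field K] {d : ℕ} (a b : List (Fin d)) (ha : WPrimitive a)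
    (hb : WPrimitive b) (L : ℕ) (y : K) (hab : ¬ List.IsRotated a b) :
    IsNilpotent ((b.map (cycM a L y)).prod) := by
  refine ⟨a.length, ?_⟩
  rw [← map_wpow_prod]
  ext i j
  by_contra hne
  apply hab
  obtain ⟨h1, -⟩ := cycM_ne a L y _ i j hne
  rw [h_wpow_length] at h1
  apply h_prim_rot a b ha hb i.val
  intro l hl
  rw [← (h1 l hl).2, h_wpow_get _ _ _ hl]

theorem cycM_self {K : Type*} [Field K] {d : ℕ} (a : List (Fin d)) (ha : WPrimitive a)
    (L : ℕ) (hL : a.length ≤ L) (y : K) :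
    (a.map (cycM a L y)).prod = Matrix.diagonal (fun i : Fin L => if i.val = 0 then y else 0) := by
  have hpos : 0 < a.length := List.length_pos_iff.mpr ha.1
  ext i j
  by_cases h0 : i.val = 0 ∧ j.val = 0
  · have hij : i = j := Fin.ext (by omega)
    subst hij
    rw [Matrix.diagonal_apply_eq, if_pos h0.1, cycM_eq a L hL y a i i (by omega)]
    · rw [Finset.prod_eq_single 0]
      · simp [h0.1]
      · intro l hl hl0
        rw [if_neg]
        rw [h0.1, zero_add, Nat.mod_eq_of_lt (by simpa using hl)]
        exact hl0
      · intro h; simp at h; exact absurd h ha.1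
    · intro l hl
      rw [h0.1, zero_add, Nat.mod_eq_of_lt hl]
    · simp [h0.1]
  · have hz : Matrix.diagonal (fun i : Fin L => if i.val = 0 then y else 0) i j = 0 := by
      by_cases hij : i = j
      · subst hij
        rw [Matrix.diagonal_apply_eq, if_neg (by tauto)]
      · exact Matrix.diagonal_apply_ne _ hij
    rw [hz]
    by_contra hne
    obtain ⟨h1, h2⟩ := cycM_ne a L y _ i j hne
    have hi := (h1 0 hpos).1
    have h2 := h2 hi
    have : a.length ∣ i.val := by
      apply h_prim_period a ha
      intro l
      have := (h1 (l % a.length) (Nat.mod_lt _ hpos)).2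
      rw [this, add_comm, Nat.add_mod_mod]
    have hi0 : i.val = 0 := Nat.eq_zero_of_dvd_of_lt this hi
    apply h0
    refine ⟨hi0, ?_⟩
    rw [h2, hi0]; simp

/-- `det (A + X)` -/
noncomputable def pdet {R : Type*} [CommRing R] {ι : Type*} [Fintype ι] [DecidableEq ι]
    (A : Matrix ι ι R) : Polynomial R :=
  (A.map Polynomial.C + (Polynomial.X : Polynomial R) • 1).det

theorem pdet_nilp {K : Type*} [Field K] {ι : Type*} [Fintype ι] [DecidableEq ι]
    (A : Matrix ι ι K) (h : IsNilpotent A) : pdet A = Polynomial.X ^ Fintype.card ι := by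
  have h1 := Matrix.isNilpotent_charpoly_sub_pow_of_isNilpotent h.neg
  have h2 := sub_eq_zero.mp h1.eq_zero
  rw [← h2, pdet, Matrix.charpoly, Matrix.charmatrix]
  congr 1
  ext i j
  simp [Matrix.scalar_apply, Matrix.one_apply, Matrix.diagonal_apply, add_comm]

theorem pdet_diag {K : Type*} [Field K] (L : ℕ) (hL : 0 < L) (y : K) :
    pdet (Matrix.diagonal (fun i : Fin L => if i.val = 0 then y else 0)) =
      Polynomial.X ^ (L - 1) * (Polynomial.X + Polynomial.C y) := by
  obtain ⟨L, rfl⟩ : ∃ r, L = r + 1 := ⟨L - 1, by omega⟩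
  rw [pdet, Matrix.diagonal_map (by simp), ← Matrix.diagonal_one, ← Matrix.diagonal_smul,
    Matrix.diagonal_add, Matrix.det_diagonal, Fin.prod_univ_succ]
  simp [add_comm, mul_comm]

theorem pdet_block {R : Type*} [CommRing R] {ι o : Type*} [Fintype ι] [DecidableEq ι]
    [Fintype o] [DecidableEq o] (A : o → Matrix ι ι R) :
    pdet (Matrix.blockDiagonal A) = ∏ k, pdet (A k) := by
  simp only [pdet]
  rw [← Matrix.det_blockDiagonal]
  congr 1
  ext ⟨i, k⟩ ⟨j, l⟩
  by_cases hkl : k = l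
  · subst hkl
    simp [Matrix.blockDiagonal_apply, Matrix.one_apply]
  · simp [Matrix.blockDiagonal_apply, hkl]

theorem pdet_reindex {R : Type*} [CommRing R] {ι κ : Type*} [Fintype ι] [DecidableEq ι]
    [Fintype κ] [DecidableEq κ] (e : κ ≃ ι) (A : Matrix ι ι R) :
    pdet (A.submatrix e e) = pdet A := by
  simp only [pdet]
  rw [← Matrix.det_submatrix_equiv_self e (A.map Polynomial.C + _)]
  congr 1
  ext i j
  simp [Matrix.one_apply]

theorem pdet_map {R S : Type*} [CommRing R] [CommRing S] {ι : Type*} [Fintype ι] [DecidableEq ι]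
    (φ : R →+* S) (A : Matrix ι ι R) :
    pdet (A.map φ) = (pdet A).map φ := by
  simp only [pdet]
  rw [← Polynomial.coe_mapRingHom, RingHom.map_det]
  congr 1
  ext i j
  by_cases h : i = j <;> simp [h]

theorem msigma_eq {R : Type*} [CommRing R] {ι : Type*} [Fintype ι] [DecidableEq ι]
    (t : ℕ) (A : Matrix ι ι R) : msigma t A = (pdet A).coeff (Fintype.card ι - t) := rfl

/-- polynomials with prescribed coefficients split -/
theorem exists_roots {K : Type*} [Field K] [IsAlgClosed K] (T : ℕ) (c : ℕ → K) :
    ∃ y : Fin T → K, ∀ t, 1 ≤ t → t ≤ T →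
      (∏ j, (Polynomial.X + Polynomial.C (y j))).coeff (T - t) = c t := by
  let q : Polynomial K := ∑ s ∈ Finset.range T, Polynomial.C (c (T - s)) * Polynomial.X ^ s
  have hq : q.degree < T := by
    rw [Polynomial.degree_lt_iff_coeff_zero]
    intro m hm
    simp only [q, Polynomial.finsetSum_coeff, Polynomial.coeff_C_mul, Polynomial.coeff_X_pow]
    apply Finset.sum_eq_zero
    intro s hs
    rw [Finset.mem_range] at hs
    rw [if_neg (by omega), mul_zero]
  let p : Polynomial K := Polynomial.X ^ T + q
  have hm : p.Monic := Polynomial.monic_X_pow_add hq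
  have hdeg : p.natDegree = T := by
    apply Polynomial.natDegree_eq_of_degree_eq_some
    exact (Polynomial.degree_add_eq_left_of_degree_lt (by simpa using hq)).trans (by simp)
  have hs := IsAlgClosed.splits p
  have hp := hs.eq_prod_roots_of_monic hm
  have hcard : p.roots.toList.length = T := by
    rw [Multiset.length_toList, ← hdeg]
    exact hs.natDegree_eq_card_roots.symm
  refine ⟨fun j => - p.roots.toList.get (Fin.cast hcard.symm j), ?_⟩
  intro t h1 h2
  have : (∏ j : Fin T, (Polynomial.X + Polynomial.C (- p.roots.toList.get (Fin.cast hcard.symm j))))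
      = p := by
    refine Eq.trans ?_ hp.symm
    conv_rhs => rw [← Multiset.coe_toList p.roots, Multiset.map_coe, Multiset.prod_coe,
      ← List.ofFn_get p.roots.toList, List.map_ofFn, List.prod_ofFn]
    rw [← (finCongr hcard.symm).prod_comp]
    simp [sub_eq_add_neg]
  rw [this]
  simp only [p, q, Polynomial.coeff_add, Polynomial.coeff_X_pow, Polynomial.finsetSum_coeff,
    Polynomial.coeff_C_mul]
  rw [if_neg (by omega), zero_add, Finset.sum_eq_single (T - t)]
  · simp [Nat.sub_sub_self h2]
  · intro s _ hs
    rw [if_neg (Ne.symm hs), mul_zero]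
  · intro h; simp at h; omega

theorem h_out_rot {d : ℕ} (A B : WCls d)
    (h : List.IsRotated (Quot.out A).1 (Quot.out B).1) : A = B := by
  rw [← Quot.out_eq A, ← Quot.out_eq B]
  exact Quot.sound h

theorem big_block {K : Type*} [Field K] [IsAlgClosed K] {d : ℕ} [DecidableEq (WCls d)] (S : Finset (WCls d)) (T L : ℕ)
    (hL : ∀ A ∈ S, (Quot.out A).1.length ≤ L) (c : ℕ → WCls d → K) :
    ∃ M : Fin d → Matrix (Fin L × (S × Fin T)) (Fin L × (S × Fin T)) K,
      ∀ A ∈ S, ∀ t, 1 ≤ t → t ≤ T →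
        msigma t (((Quot.out A).1.map M).prod) = c t A := by
  choose y hy using fun A : WCls d => exists_roots T (fun t => c t A)
  let N : (S × Fin T) → Fin d → Matrix (Fin L) (Fin L) K :=
    fun o => cycM (Quot.out o.1.1).1 L (y o.1.1 o.2)
  refine ⟨fun k => Matrix.blockDiagonal (fun o => N o k), ?_⟩
  intro A hA t h1 h2
  have hL0 : 0 < L := lt_of_lt_of_le (List.length_pos_iff.mpr (Quot.out A).2.1) (hL A hA)
  have hprod : ∀ w : List (Fin d), (w.map (fun k => Matrix.blockDiagonal (fun o => N o k))).prod
      = Matrix.blockDiagonal (fun o => (w.map (N o)).prod) := by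
    intro w
    induction w with
    | nil => simp only [List.map_nil, List.prod_nil]; exact Matrix.blockDiagonal_one.symm
    | cons k w ih =>
      simp only [List.map_cons, List.prod_cons]
      rw [ih, ← Matrix.blockDiagonal_mul]
  rw [hprod, msigma_eq, pdet_block, Fintype.prod_prod_type]
  have hA1 : ∀ j, pdet (((Quot.out A).1.map (N (⟨A, hA⟩, j))).prod)
      = Polynomial.X ^ (L - 1) * (Polynomial.X + Polynomial.C (y A j)) := by
    intro j
    rw [← pdet_diag L hL0, ← cycM_self (Quot.out A).1 (Quot.out A).2 L (hL A hA)]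
  have hA2 : ∀ B : S, B ≠ ⟨A, hA⟩ → ∀ j, pdet (((Quot.out A).1.map (N (B, j))).prod)
      = Polynomial.X ^ L := by
    intro B hB j
    rw [pdet_nilp, Fintype.card_fin]
    apply cycM_nilp _ _ (Quot.out B.1).2 (Quot.out A).2
    intro h
    exact hB (Subtype.ext (h_out_rot _ _ h))
  rw [← Finset.mul_prod_erase _ _ (Finset.mem_univ (⟨A, hA⟩ : S))]
  rw [Finset.prod_congr (s₁ := Finset.univ.erase _) rfl
    (fun B hB => Finset.prod_congr rfl (fun j _ => hA2 B (Finset.ne_of_mem_erase hB) j))]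
  rw [Finset.prod_congr rfl (fun j _ => hA1 j), Finset.prod_mul_distrib]
  simp only [Finset.prod_const, Finset.card_univ, Fintype.card_fin, Fintype.card_prod,
    Finset.card_erase_of_mem (Finset.mem_univ (⟨A, hA⟩ : S))]
  have hc : 0 < Fintype.card S := Fintype.card_pos_iff.mpr ⟨⟨A, hA⟩⟩
  obtain ⟨s, hs⟩ : ∃ s, Fintype.card S = s + 1 := ⟨_, (Nat.sub_add_cancel hc).symm⟩
  obtain ⟨r, rfl⟩ : ∃ r, L = r + 1 := ⟨L - 1, by omega⟩
  rw [hs, mul_right_comm, ← pow_mul, ← pow_mul, ← pow_mul, ← pow_add, Nat.add_sub_cancel,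
    Nat.add_sub_cancel]
  have e : (r + 1) * ((s + 1) * T) - t = (T - t) + (r * T + (r + 1) * (T * s)) := by
    have : (r + 1) * ((s + 1) * T) = T + (r * T + (r + 1) * (T * s)) := by ring
    omega
  rw [e, Polynomial.coeff_X_pow_mul, hy A t h1 h2]

theorem psi_eval {F K : Type*} [Field F] [Field K] [Algebra F K] {d n : ℕ} {ι : Type*}
    [Fintype ι] [DecidableEq ι] (e : Fin n ≃ ι) (M : Fin d → Matrix ι ι K)
    (w : List (Fin d)) (t : ℕ) :
    (MvPolynomial.aeval (fun p : Fin n × Fin n × Fin d => M p.2.2 (e p.1) (e p.2.1)) :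
      Rmat F n d →ₐ[F] K) (msigma t (glWordMat F n d w)) = msigma t ((w.map M).prod) := by
  set φ := (MvPolynomial.aeval (fun p : Fin n × Fin n × Fin d => M p.2.2 (e p.1) (e p.2.1)) :
      Rmat F n d →ₐ[F] K) with hφ
  have h1 : (glWordMat F n d w).map (φ : Rmat F n d →+* K) = ((w.map M).prod).submatrix e e := by
    unfold glWordMat
    induction w with
    | nil => 
      simp
    | cons k w ih =>
      simp only [List.map_cons, List.prod_cons]
      rw [Matrix.map_mul, ih, Matrix.submatrix_mul_equiv (M k) _ e e e |>.symm]
      congr 1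
      ext i j
      simp [genX, hφ]
  rw [msigma_eq, msigma_eq, ← pdet_reindex e, ← h1, pdet_map, Polynomial.coeff_map,
    Fintype.card_congr e]
  rfl

/-- **Remark 5.2 (Donkin's theorem).** Over an infinite field of arbitrary
characteristic, the ideal of free relations for matrix `GL(n)`-invariants is zero. -/
theorem free_relations_general_linear (F : Type*) [Field F] [Infinite F]
    (d : ℕ) (hd : 1 ≤ d) (f : Nsigma F d)
    (hf : ∀ n : ℕ, 1 ≤ n → PsiGL F n d f = 0) : f = 0 := by
  classical
  apply MvPolynomial.funext
  intro c
  rw [map_zero]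
  let K := AlgebraicClosure F
  have key : ∃ n, 1 ≤ n ∧ ∃ φ : Rmat F n d →ₐ[F] K, ∀ v ∈ f.vars,
      φ (PsiGL F n d (MvPolynomial.X v)) = algebraMap F K (c v) := by
    by_cases hv : f.vars = ∅
    · exact ⟨1, le_rfl, MvPolynomial.aeval (fun _ => 0), by simp [hv]⟩
    · obtain ⟨v0, hv0⟩ := Finset.nonempty_iff_ne_empty.mpr hv
      let S : Finset (WCls d) := f.vars.image Prod.snd
      let T : ℕ := f.vars.sup (fun v => (v.1 : ℕ))
      let L : ℕ := S.sup (fun A => (Quot.out A).1.length)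
      have hT : ∀ v ∈ f.vars, (v.1 : ℕ) ≤ T := fun v h =>
        Finset.le_sup (f := fun v : ℕ+ × WCls d => (v.1 : ℕ)) h
      have hL : ∀ A ∈ S, (Quot.out A).1.length ≤ L := fun A h =>
        Finset.le_sup (f := fun A : WCls d => (Quot.out A).1.length) h
      have hS : ∀ v ∈ f.vars, v.2 ∈ S := fun v h => Finset.mem_image_of_mem _ h
      obtain ⟨M, hM⟩ := big_block (K := K) S T L hL
        (fun t A => if h : 0 < t then algebraMap F K (c (⟨t, h⟩, A)) else 0)
      let n := Fintype.card (Fin L × (S × Fin T))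
      have hTn : T ≤ n := by
        have h1 : 0 < L := lt_of_lt_of_le
          (List.length_pos_iff.mpr (Quot.out v0.2).2.1) (hL _ (hS v0 hv0))
        have h2 : 0 < Fintype.card S := Fintype.card_pos_iff.mpr ⟨⟨v0.2, hS v0 hv0⟩⟩
        simp only [n, Fintype.card_prod, Fintype.card_fin]
        rw [← mul_assoc]
        exact Nat.le_mul_of_pos_left _ (Nat.mul_pos h1 h2)
      have hn : 1 ≤ n := (v0.1.pos.trans_le (hT v0 hv0)).trans_le hTn
      refine ⟨n, hn, MvPolynomial.aeval (fun p : Fin n × Fin n × Fin d =>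
        M p.2.2 ((Fintype.equivFin _).symm p.1) ((Fintype.equivFin _).symm p.2.1)), ?_⟩
      intro v hv
      rw [PsiGL, MvPolynomial.aeval_X, if_pos ((hT v hv).trans hTn), psi_eval,
        hM v.2 (hS v hv) _ v.1.pos (hT v hv), dif_pos v.1.pos]
      rfl
  obtain ⟨n, hn, φ, hφ⟩ := key
  have h0 : φ (PsiGL F n d f) = 0 := by rw [hf n hn, map_zero]
  have h1 : φ (PsiGL F n d f) = algebraMap F K (MvPolynomial.eval c f) := by
    have e1 : φ.comp (PsiGL F n d) =
        MvPolynomial.aeval (fun v => φ (PsiGL F n d (MvPolynomial.X v))) := by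
      apply MvPolynomial.algHom_ext
      intro v
      simp
    have e2 : algebraMap F K (MvPolynomial.eval c f) =
        MvPolynomial.aeval (fun v => algebraMap F K (c v)) f := by
      exact (MvPolynomial.aeval_algebraMap_apply K c f).symm
    rw [e2, ← AlgHom.comp_apply, e1]
    exact MvPolynomial.eval₂Hom_congr' rfl (fun v hv _ => hφ v hv) rfl
  rw [h0] at h1
  exact (FaithfulSMul.algebraMap_injective F K) (by rw [← h1, map_zero])
end

section
/- (Lemma 6.1.) Let F be an infinite field of arbitrary characteristic. The ideal K(Q,ι) of free relations for invariants of mixed representations of the quiver Q is zero: if f ∈ N_σ(Q,ι) satisfies Υ_n(f) = 0 for every dimension vector n with n_{ι(v)} = n_v for all v, then f = 0. -/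
/-! Statement 19: (Lemma 6.1.) The ideal of free relations for invariants of mixed
representations of a quiver is zero. -/

open scoped BigOperators
open Matrix

/-- The transpose of a word: reverse it and apply the involution to each letter. -/
def wordT {A : Type*} (τ : A → A) (w : List A) : List A := (w.reverse).map τ

/-- `a ∼ b`: `b` is a cyclic permutation of `a` or of `a^T`. -/
def simRel {A : Type*} (τ : A → A) (a b : List A) : Prop :=
  List.IsRotated a b ∨ List.IsRotated a (wordT τ b)

section MixedQuiver

/- A finite quiver `Q = (Q0, Q1)` with head and tail maps `hd, tl : Q1 → Q0`, and an
involution `ι` of the vertex set. Arrows of the double quiver `Q^D` are `Q1 ⊕ Q1`,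
where `Sum.inl a = a` and `Sum.inr a = a^T`. -/
variable (Q0 Q1 : Type) [Fintype Q0] [Fintype Q1] [DecidableEq Q0]
variable (hd tl : Q1 → Q0) (ι : Q0 → Q0)

/-- The head of an arrow of the double quiver: `(a)' = a'`, `(a^T)' = ι(a'')`. -/
def dhd : Q1 ⊕ Q1 → Q0
  | Sum.inl a => hd a
  | Sum.inr a => ι (tl a)

/-- The tail of an arrow of the double quiver: `(a)'' = a''`, `(a^T)'' = ι(a')`. -/
def dtl : Q1 ⊕ Q1 → Q0
  | Sum.inl a => tl a
  | Sum.inr a => ι (hd a)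

/-- A closed path in `Q^D`: a nonempty composable sequence of arrows whose head equals
its tail (paths are written from left to right: `a = a_1 ⋯ a_r` with `a_i'' = a_{i+1}'`,
head `a_1'` and tail `a_r''`). -/
def IsClosedPath (l : List (Q1 ⊕ Q1)) : Prop :=
  ∃ h : l ≠ [],
    l.Chain' (fun x y => dtl Q0 Q1 hd tl ι x = dhd Q0 Q1 hd tl ι y) ∧
      dhd Q0 Q1 hd tl ι (l.head h) = dtl Q0 Q1 hd tl ι (l.getLast h)

/-- A primitive closed path: a closed path that is not a power `e^m`, `m ≥ 2`, of a
shorter (closed) path. -/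
def IsPrimClosedPath (l : List (Q1 ⊕ Q1)) : Prop :=
  IsClosedPath Q0 Q1 hd tl ι l ∧ ∀ (e : List (Q1 ⊕ Q1)) (m : ℕ), 2 ≤ m → l ≠ wpow e m

/-- The set of primitive closed paths in `Q^D`. -/
def PrimPath := {l : List (Q1 ⊕ Q1) // IsPrimClosedPath Q0 Q1 hd tl ι l}

/-- `∼`-equivalence classes of primitive closed paths (`T` on paths reverses the path
and applies `inl a ↔ inr a`, i.e. `a ↔ a^T`, to each arrow). -/
def QCls := Quot (fun a b : PrimPath Q0 Q1 hd tl ι => simRel Sum.swap a.1 b.1)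

/-- The polynomial algebra `N_σ(Q,ι)` on indeterminates `σ_t(ā)`, `t ≥ 1`,
`ā` a `∼`-class of primitive closed paths in `Q^D`. -/
abbrev NsigmaQ (F : Type*) [CommSemiring F] := MvPolynomial (ℕ+ × QCls Q0 Q1 hd tl ι) F

/-- The head vertex of a (primitive closed) path. -/
noncomputable def pathHead (c : PrimPath Q0 Q1 hd tl ι) : Q0 :=
  dhd Q0 Q1 hd tl ι (c.1.head c.2.1.choose)

/-- The coordinate ring `R = F[x_{ij}^a]`, `a ∈ Q1`, `1 ≤ i ≤ n_{a'}`, `1 ≤ j ≤ n_{a''}`,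
for a dimension vector `n`. -/
abbrev RQ (F : Type*) [CommSemiring F] (n : Q0 → ℕ+) :=
  MvPolynomial ((a : Q1) × (Fin (n (hd a)) × Fin (n (tl a)))) F

/-- The matrix of an arrow of the double quiver, realized on the total space
`⊕_v F^{n_v}`: the generic matrix `X_a` (resp. `X_aᵀ`) placed in the block with rows
`a'` and columns `a''` (resp. rows `ι(a'')` and columns `ι(a')`), all other entries
being `0`. The block of the product of these matrices along a closed path with head `v`
at `(v, v)` is then exactly the product `X_{a_1} ⋯ X_{a_r}` of the corresponding
generic/transposed generic matrices. -/
noncomputable def arrowMat (F : Type*) [Field F] (n : Q0 → ℕ+)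
    (hn : ∀ v, n (ι v) = n v) (ar : Q1 ⊕ Q1) :
    Matrix ((v : Q0) × Fin (n v)) ((v : Q0) × Fin (n v)) (RQ Q0 Q1 hd tl F n) :=
  match ar with
  | Sum.inl a =>
      Matrix.of fun p q =>
        if h : p.1 = hd a ∧ q.1 = tl a then
          MvPolynomial.X ⟨a, (Fin.cast (by rw [h.1]) p.2, Fin.cast (by rw [h.2]) q.2)⟩
        else 0
  | Sum.inr a =>
      Matrix.of fun p q =>
        if h : p.1 = ι (tl a) ∧ q.1 = ι (hd a) then
          MvPolynomial.X
            ⟨a, (Fin.cast (by rw [h.2, hn]) q.2, Fin.cast (by rw [h.1, hn]) p.2)⟩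
        else 0

/-- The matrix `X_a` of a path `a = a_1 ⋯ a_r` in `Q^D` (on the total space). -/
noncomputable def pathMat (F : Type*) [Field F] (n : Q0 → ℕ+)
    (hn : ∀ v, n (ι v) = n v) (l : List (Q1 ⊕ Q1)) :
    Matrix ((v : Q0) × Fin (n v)) ((v : Q0) × Fin (n v)) (RQ Q0 Q1 hd tl F n) :=
  (l.map (arrowMat Q0 Q1 hd tl ι F n hn)).prod

/-- The `n_v × n_v` block at a vertex `v` of a matrix on the total space. -/
noncomputable def blockAt (F : Type*) [Field F] (n : Q0 → ℕ+)
    (M : Matrix ((v : Q0) × Fin (n v)) ((v : Q0) × Fin (n v)) (RQ Q0 Q1 hd tl F n))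
    (v : Q0) : Matrix (Fin (n v)) (Fin (n v)) (RQ Q0 Q1 hd tl F n) :=
  M.submatrix (fun i => ⟨v, i⟩) (fun j => ⟨v, j⟩)

/-- The evaluation homomorphism `Υ_n : N_σ(Q,ι) → R`, sending `σ_t(ā)` to `σ_t(X_a)` if
`t ≤ n_{a'}` and to `0` otherwise (it does not depend on the representative of `ā`). -/
noncomputable def UpsilonQ (F : Type*) [Field F] (n : Q0 → ℕ+)
    (hn : ∀ v, n (ι v) = n v) :
    NsigmaQ Q0 Q1 hd tl ι F →ₐ[F] RQ Q0 Q1 hd tl F n :=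
  MvPolynomial.aeval fun v : ℕ+ × QCls Q0 Q1 hd tl ι =>
    if (v.1 : ℕ) ≤ (n (pathHead Q0 Q1 hd tl ι (Quot.out v.2)) : ℕ) then
      msigma v.1
        (blockAt Q0 Q1 hd tl F n
          (pathMat Q0 Q1 hd tl ι F n hn (Quot.out v.2).1)
          (pathHead Q0 Q1 hd tl ι (Quot.out v.2)))
    else 0


/-! ### Auxiliary lemmas -/

theorem aux_det {n K : Type*} [Fintype n] [DecidableEq n] [CommRing K]
    (M : Matrix n n K) (h : n → ℕ) (hM : ∀ p q, p ≠ q → M p q ≠ 0 → h q < h p) :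
    M.det = ∏ p, M p p := by
  rw [Matrix.det_apply, Finset.sum_eq_single (1 : Equiv.Perm n)]
  · simp
  · intro σ _ hσ
    have : ∃ i, M (σ i) i = 0 := by
      by_contra hcon
      push Not at hcon
      have hle : ∀ i ∈ (Finset.univ : Finset n), h i ≤ h (σ i) := by
        intro i _
        by_cases hi : σ i = i
        · rw [hi]
        · exact (hM _ _ hi (hcon i)).le
      have hsum : ∑ i, h i = ∑ i, h (σ i) := (Equiv.sum_comp σ h).symm
      have := (Finset.sum_eq_sum_iff_of_le hle).1 hsum
      apply hσ
      refine Equiv.ext fun i => ?_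
      by_contra hi
      change σ i ≠ i at hi
      have h1 := hM _ _ hi (hcon i)
      have h2 := this i (Finset.mem_univ i)
      omega
    obtain ⟨i, hi⟩ := this
    have h0 : ∏ j, M (σ j) j = 0 := Finset.prod_eq_zero (Finset.mem_univ i) hi
    rw [h0, smul_zero]
  · intro h; exact absurd (Finset.mem_univ _) h

theorem aux_vieta {K : Type*} [Field K] [IsAlgClosed K] (T : ℕ) (z : ℕ → K) :
    ∃ y : Fin T → K, ∀ t, 1 ≤ t → t ≤ T →
      (∏ s, ((Polynomial.X : Polynomial K) + Polynomial.C (y s))).coeff (T - t) = z t := by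
  classical
  let q : Polynomial K := ∑ i ∈ Finset.range T, Polynomial.C (z (T - i)) * Polynomial.X ^ i
  have hq : q.degree < T := by
    apply lt_of_le_of_lt (Polynomial.degree_sum_le _ _)
    refine (Finset.sup_lt_iff (WithBot.bot_lt_coe T)).2 ?_
    intro i hi
    exact lt_of_le_of_lt (Polynomial.degree_C_mul_X_pow_le _ _)
      (WithBot.coe_lt_coe.2 (Finset.mem_range.1 hi))
  let p : Polynomial K := Polynomial.X ^ T + q
  have hpm : p.Monic := Polynomial.monic_X_pow_add hq
  have hdeg : p.natDegree = T := by
    apply Polynomial.natDegree_eq_of_degree_eq_some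
    rw [Polynomial.degree_add_eq_left_of_degree_lt] <;> simp [hq]
  have hsp : p.Splits := IsAlgClosed.splits p
  have hcard : p.roots.toList.length = T := by
    rw [Multiset.length_toList, ← hsp.natDegree_eq_card_roots, hdeg]
  refine ⟨fun s => - p.roots.toList.get (s.cast hcard.symm), fun t h1 h2 => ?_⟩
  have hp : (∏ s : Fin T, ((Polynomial.X : Polynomial K) +
      Polynomial.C (- p.roots.toList.get (s.cast hcard.symm)))) = p := by
    conv_rhs => rw [hsp.eq_prod_roots_of_monic hpm]
    have hR : (p.roots.map fun a => Polynomial.X - Polynomial.C a).prod =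
        (p.roots.toList.map fun a => Polynomial.X - Polynomial.C a).prod := by
      conv_lhs => rw [← Multiset.coe_toList p.roots, Multiset.map_coe, Multiset.prod_coe]
    rw [hR]
    have : ∀ (l : List K) (h : l.length = T), (∏ s : Fin T, ((Polynomial.X : Polynomial K) +
      Polynomial.C (- l.get (s.cast h.symm)))) = (l.map fun a => Polynomial.X - Polynomial.C a).prod := by
      intro l h
      subst h
      rw [← List.prod_ofFn]
      congr 1
      apply List.ext_getElem <;> simp [sub_eq_add_neg]
    simpa using this _ hcard
  rw [hp]
  simp only [p, q, Polynomial.coeff_add, Polynomial.coeff_X_pow, Polynomial.finsetSum_coeff,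
    Polynomial.coeff_C_mul]
  rw [if_neg (by omega), zero_add, Finset.sum_eq_single (T - t)]
  · simp; congr 1; omega
  · intro i _ hi; rw [if_neg (Ne.symm hi), mul_zero]
  · intro h; exact absurd (Finset.mem_range.2 (by omega)) h

theorem aux_prod {A I' I K : Type*} [Fintype I'] [DecidableEq I'] [DecidableEq I] [CommRing K]
    (E : I' ≃ I) (M : A → Matrix I' I' K) (g : I → I) (L : I → Option A) (wt : I → K)
    (hM : ∀ x P Q, M x P Q = open Classical in
      if E Q = g (E P) ∧ L (E P) = some x then wt (E P) else 0)
    (l : List A) (P Q : I') :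
    (l.map M).prod P Q = open Classical in
      if E Q = g^[l.length] (E P) ∧ (∀ i (h : i < l.length), L (g^[i] (E P)) = some l[i]) then
        ∏ i ∈ Finset.range l.length, wt (g^[i] (E P)) else 0 := by
  classical
  induction l generalizing P with
  | nil => 
    simp [Matrix.one_apply, eq_comm]
  | cons x l ih =>
    rw [List.map_cons, List.prod_cons, Matrix.mul_apply,
      Finset.sum_eq_single (E.symm (g (E P)))]
    · rw [hM, ih]
      simp only [Equiv.apply_symm_apply, true_and, List.length_cons, Function.iterate_succ,
        Function.comp, Finset.prod_range_succ']
      have : (∀ i (h : i < l.length + 1), L (g^[i] (E P)) = some (x :: l)[i]) ↔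
          L (E P) = some x ∧ ∀ i (h : i < l.length), L (g^[i] (g (E P))) = some l[i] := by
        constructor
        · intro h
          refine ⟨by simpa using h 0 (by omega), fun i hi => ?_⟩
          exact h (i+1) (by omega)
        · rintro ⟨h1, h2⟩ i hi
          cases i with
          | zero => simpa using h1
          | succ i => exact h2 i (by omega)
      simp only [this]
      by_cases h1 : L (E P) = some x
      · simp only [h1, if_true, true_and]
        split_ifs
        · simp [mul_comm]
        · simp
      · simp [h1]
    · intro R _ hR
      rw [hM, if_neg, zero_mul]
      rintro ⟨h, -⟩
      exact hR (by rw [← h]; simp)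
    · intro h; exact absurd (Finset.mem_univ _) h

theorem aux_rank {A I : Type*} (g : I → I) (L : I → Option A) (b : ℕ → A) (r : ℕ) (hr : 0 < r)
    (hb : ∀ i, b (i + r) = b i) :
    ∃ m : I → ℕ, ∀ P, (∀ i, i < r → L (g^[i] P) = some (b i)) →
      (∃ i, L (g^[i] P) ≠ some (b i)) → m (g^[r] P) < m P := by
  classical
  refine ⟨fun P => if h : ∃ i, L (g^[i] P) ≠ some (b i) then Nat.find h else 0, ?_⟩
  intro P h1 h2
  have h3 : r ≤ Nat.find h2 := by
    by_contra hlt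
    exact Nat.find_spec h2 (h1 _ (by omega))
  obtain ⟨i1, hi1⟩ := Nat.exists_eq_add_of_le h3
  have h4 : L (g^[i1] (g^[r] P)) ≠ some (b i1) := by
    have := Nat.find_spec h2
    rwa [hi1, add_comm r i1, hb, Function.iterate_add_apply] at this
  have h5 : ∃ i, L (g^[i] (g^[r] P)) ≠ some (b i) := ⟨_, h4⟩
  simp only [dif_pos h2, dif_pos h5]
  have := Nat.find_min' h5 h4
  omega

theorem aux_msigma_map {R K : Type*} [CommRing R] [CommRing K] {n : Type*} [Fintype n]
    [DecidableEq n] (φ : R →+* K) (t : ℕ) (A : Matrix n n R) :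
    φ (msigma t A) = msigma t (A.map φ) := by
  unfold msigma
  rw [← Polynomial.coeff_map, ← Polynomial.coe_mapRingHom, RingHom.map_det]
  congr 2
  ext i j
  by_cases h : i = j <;> simp [h]

/-- final determinant computation -/
theorem aux_sigma {n K : Type*} [Fintype n] [DecidableEq n] [CommRing K] (T t : ℕ) (ht : 1 ≤ t)
    (htT : t ≤ T) (M : Matrix n n K) (h : n → ℕ) (u : Fin T → n) (hu : Function.Injective u)
    (y : Fin T → K) (hdiag : ∀ s, M (u s) (u s) = y s)
    (hM : ∀ p q, M p q ≠ 0 → (p = q ∧ p ∈ Set.range u) ∨ h q < h p) :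
    msigma t M = (∏ s, ((Polynomial.X : Polynomial K) + Polynomial.C (y s))).coeff (T - t) := by
  unfold msigma
  have hc : T ≤ Fintype.card n := by simpa using Fintype.card_le_of_injective u hu
  rw [aux_det _ h]
  · have : ∀ p, (M.map Polynomial.C + (Polynomial.X : Polynomial K) • (1 : Matrix n n (Polynomial K)) : Matrix n n (Polynomial K)) p p
        = Polynomial.X + Polynomial.C (M p p) := by
      intro p; simp [add_comm]
    simp only [this]
    rw [← Finset.prod_mul_prod_compl (Finset.univ.map ⟨u, hu⟩), Finset.prod_map]
    have h2 : ∏ p ∈ (Finset.univ.map ⟨u, hu⟩)ᶜ, (Polynomial.X + Polynomial.C (M p p)) =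
        Polynomial.X ^ (Fintype.card n - T) := by
      rw [Finset.prod_congr rfl (g := fun _ => (Polynomial.X : Polynomial K))]
      · simp [Finset.card_compl]
      · intro p hp
        have : M p p = 0 := by
          by_contra hne
          rcases hM p p hne with ⟨-, s, hs⟩ | h'
          · simp at hp; exact hp s hs
          · omega
        simp [this]
    rw [h2, mul_comm]
    have h3 : Fintype.card n - t = (T - t) + (Fintype.card n - T) := by omega
    rw [h3, Polynomial.coeff_X_pow_mul]
    simp [hdiag]
  · intro p q hpq hne
    have : M p q ≠ 0 := by
      intro h0; apply hne; simp [h0, hpq]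
    rcases hM p q this with h' | h'
    · exact absurd h'.1 hpq
    · exact h'

/-- Abstract data on a family of cyclic words. -/
structure GoodWords {V A J : Type} (h t : A → V) (τ : A → A) (inv : V → V) (r : J → ℕ)
    (c : ∀ j, ZMod (r j) → A) : Prop where
  inv_inv : ∀ v, inv (inv v) = v
  inv_ne : ∀ v, inv v ≠ v
  tau_tau : ∀ x, τ (τ x) = x
  h_tau : ∀ x, h (τ x) = inv (t x)
  t_tau : ∀ x, t (τ x) = inv (h x)
  closed : ∀ j k, t (c j k) = h (c j (k + 1))
  full_plus : ∀ j j0 k, (∀ i : ℕ, c j (k + i) = c j0 i) →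
    (⟨j, k⟩ : Σ j, ZMod (r j)) = ⟨j0, 0⟩
  full_minus : ∀ j j0 k, ¬ ∀ i : ℕ, τ (c j (k - i)) = c j0 i

/-- index of states -/
abbrev DynB {J : Type} (r : J → ℕ) (T : ℕ) := Σ j : J, Fin T × ZMod (r j)

open Classical in
/-- successor -/
noncomputable def dynG {V A J : Type} (h : A → V) (inv : V → V) (r : J → ℕ)
    (c : ∀ j, ZMod (r j) → A) (T : ℕ) :
    V × Option (DynB r T) → V × Option (DynB r T)
  | (v, none) => (v, none)
  | (v, some ⟨j, s, k⟩) =>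
    if v = h (c j k) then (h (c j (k + 1)), some ⟨j, s, k + 1⟩)
    else if v = inv (h (c j k)) then (inv (h (c j (k - 1))), some ⟨j, s, k - 1⟩)
    else (v, some ⟨j, s, k⟩)

open Classical in
/-- label -/
noncomputable def dynL {V A J : Type} (h : A → V) (τ : A → A) (inv : V → V) (r : J → ℕ)
    (c : ∀ j, ZMod (r j) → A) (T : ℕ) :
    V × Option (DynB r T) → Option A
  | (_, none) => none
  | (v, some ⟨j, _, k⟩) =>
    if v = h (c j k) then some (c j k)
    else if v = inv (h (c j k)) then some (τ (c j (k - 1)))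
    else none

open Classical in
/-- weight -/
noncomputable def dynW {V A J K : Type*} [One K] (h : A → V) (r : J → ℕ)
    (c : ∀ j, ZMod (r j) → A) (T : ℕ) (y : J → Fin T → K) :
    V × Option (Σ j : J, Fin T × ZMod (r j)) → K
  | (_, none) => 1
  | (v, some ⟨j, s, k⟩) =>
    if v = h (c j k) then (if k = 0 then y j s else 1)
    else (if k - 1 = 0 then y j s else 1)

section Dyn
variable {V A J : Type} {h t : A → V} {τ : A → A} {inv : V → V} {r : J → ℕ}
    {c : ∀ j, ZMod (r j) → A}

theorem dyn_cases (T : ℕ) (P : V × Option (DynB r T)) :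
    (∃ j s k, P = (h (c j k), some ⟨j, s, k⟩)) ∨
    (∃ j s k, P = (inv (h (c j k)), some ⟨j, s, k⟩)) ∨
    (dynL h τ inv r c T P = none) := by
  obtain ⟨v, _ | ⟨j, s, k⟩⟩ := P
  · right; right; rfl
  · by_cases h1 : v = h (c j k)
    · left; exact ⟨j, s, k, by rw [h1]⟩
    · by_cases h2 : v = inv (h (c j k))
      · right; left; exact ⟨j, s, k, by rw [h2]⟩
      · right; right; simp [dynL, h1, h2]

theorem dynG_plus (T : ℕ) (j s k) : dynG h inv r c T (h (c j k), some ⟨j, s, k⟩) =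
    (h (c j (k + 1)), some ⟨j, s, k + 1⟩) := by simp [dynG]

theorem dynL_plus (T : ℕ) (j s k) : dynL h τ inv r c T (h (c j k), some ⟨j, s, k⟩) =
    some (c j k) := by simp [dynL]

theorem dynG_minus (W : GoodWords h t τ inv r c) (T : ℕ) (j s k) :
    dynG h inv r c T (inv (h (c j k)), some ⟨j, s, k⟩) =
    (inv (h (c j (k - 1))), some ⟨j, s, k - 1⟩) := by simp [dynG, W.inv_ne]

theorem dynL_minus (W : GoodWords h t τ inv r c) (T : ℕ) (j s k) :
    dynL h τ inv r c T (inv (h (c j k)), some ⟨j, s, k⟩) =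
    some (τ (c j (k - 1))) := by simp [dynL, W.inv_ne]

theorem dynG_plus_iter (T : ℕ) (j s k) (i : ℕ) :
    (dynG h inv r c T)^[i] (h (c j k), some ⟨j, s, k⟩) =
    (h (c j (k + i)), some ⟨j, s, k + i⟩) := by
  induction i with
  | zero => simp
  | succ i ih => rw [Function.iterate_succ_apply', ih, dynG_plus]; simp [add_assoc]

theorem dynG_minus_iter (W : GoodWords h t τ inv r c) (T : ℕ) (j s k) (i : ℕ) :
    (dynG h inv r c T)^[i] (inv (h (c j k)), some ⟨j, s, k⟩) =
    (inv (h (c j (k - i))), some ⟨j, s, k - i⟩) := by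
  induction i with
  | zero => simp
  | succ i ih => rw [Function.iterate_succ_apply', ih, dynG_minus W]; simp [sub_sub]

theorem dyn_full (W : GoodWords h t τ inv r c) (T : ℕ) (P : V × Option (DynB r T)) (j0 : J)
    (hP : ∀ i : ℕ, dynL h τ inv r c T ((dynG h inv r c T)^[i] P) = some (c j0 i)) :
    ∃ s, P = (h (c j0 0), some ⟨j0, s, 0⟩) := by
  rcases dyn_cases (h := h) (τ := τ) (inv := inv) (c := c) T P with
    ⟨j, s, k, rfl⟩ | ⟨j, s, k, rfl⟩ | h0
  · simp only [dynG_plus_iter, dynL_plus, Option.some.injEq] at hP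
    have := W.full_plus j j0 k hP
    obtain ⟨rfl, h2⟩ := Sigma.mk.inj_iff.1 this
    obtain rfl := eq_of_heq h2
    exact ⟨s, rfl⟩
  · simp only [dynG_minus_iter W, dynL_minus W, Option.some.injEq] at hP
    refine absurd (fun i => ?_) (W.full_minus j j0 (k - 1))
    rw [← hP i]; congr 2; ring
  · have := hP 0
    simp [h0] at this

theorem dyn_ht (W : GoodWords h t τ inv r c) (T : ℕ) (P : V × Option (DynB r T)) (x : A)
    (hP : dynL h τ inv r c T P = some x) :
    P.1 = h x ∧ (dynG h inv r c T P).1 = t x := by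
  rcases dyn_cases (h := h) (τ := τ) (inv := inv) (c := c) T P with
    ⟨j, s, k, rfl⟩ | ⟨j, s, k, rfl⟩ | h0
  · rw [dynL_plus] at hP
    obtain rfl := Option.some.inj hP
    simp [dynG_plus, W.closed]
  · rw [dynL_minus W] at hP
    obtain rfl := Option.some.inj hP
    simp [dynG_minus W, W.h_tau, W.t_tau, W.closed]
  · simp [h0] at hP

theorem dyn_flip {K : Type*} [One K] (W : GoodWords h t τ inv r c) (T : ℕ) (y : J → Fin T → K)
    (P Q : V × Option (DynB r T)) (x : A)
    (hQ : Q = dynG h inv r c T P)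
    (hP : dynL h τ inv r c T P = some x) :
    ((inv P.1, P.2) = dynG h inv r c T (inv Q.1, Q.2) ∧
    dynL h τ inv r c T (inv Q.1, Q.2) = some (τ x)) ∧
    dynW h r c T y (inv Q.1, Q.2) = dynW h r c T y P := by
  subst hQ
  rcases dyn_cases (h := h) (τ := τ) (inv := inv) (c := c) T P with
    ⟨j, s, k, rfl⟩ | ⟨j, s, k, rfl⟩ | h0
  · rw [dynL_plus] at hP
    obtain rfl := Option.some.inj hP
    simp [dynG_plus, dynG_minus W, dynL_minus W, dynW, W.inv_ne]
  · rw [dynL_minus W] at hP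
    obtain rfl := Option.some.inj hP
    simp [dynG_minus W, W.inv_inv, dynG_plus, dynL_plus, W.tau_tau, dynW, W.inv_ne]
  · simp [h0] at hP

theorem dyn_flip_iff (W : GoodWords h t τ inv r c) (T : ℕ)
    (P Q : V × Option (DynB r T)) (x : A) :
    (Q = dynG h inv r c T P ∧ dynL h τ inv r c T P = some x) ↔
    ((inv P.1, P.2) = dynG h inv r c T (inv Q.1, Q.2) ∧
    dynL h τ inv r c T (inv Q.1, Q.2) = some (τ x)) := by
  constructor
  · rintro ⟨h1, h2⟩
    exact (dyn_flip W T (fun _ _ => (1 : ℕ)) P Q x h1 h2).1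
  · rintro ⟨h1, h2⟩
    have := (dyn_flip W T (fun _ _ => (1 : ℕ)) _ _ _ h1 h2).1
    simpa [W.inv_inv, W.tau_tau] using this

theorem dyn_wprod {K : Type*} [CommRing K] [∀ j, NeZero (r j)]
    (T : ℕ) (y : J → Fin T → K) (j s) :
    ∏ i ∈ Finset.range (r j),
      dynW h r c T y ((dynG h inv r c T)^[i] (h (c j 0), some ⟨j, s, 0⟩)) = y j s := by
  rw [Finset.prod_eq_single 0]
  · simp [dynW]
  · intro i hi hi0
    rw [dynG_plus_iter]
    have : (i : ZMod (r j)) ≠ 0 := by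
      rw [Ne, ZMod.natCast_eq_zero_iff]
      intro hd
      have := Nat.le_of_dvd (Nat.pos_of_ne_zero hi0) hd
      have := Finset.mem_range.1 hi
      omega
    simp [dynW, this]
  · intro h0
    exact absurd (Finset.mem_range.2 (Nat.pos_of_ne_zero (NeZero.ne (r j)))) h0

end Dyn

/-! ### words -/

section Words
variable {A : Type}

/-- letter at a cyclic position -/
def cyc (l : List A) (hl : l ≠ []) (k : ZMod l.length) : A :=
  haveI : NeZero l.length := ⟨by simpa using hl⟩
  l[k.val]'(ZMod.val_lt k)

theorem cyc_nat (l : List A) (hl : l ≠ []) (i : ℕ) :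
    cyc l hl i = l[i % l.length]'(Nat.mod_lt _ (List.length_pos_of_ne_nil hl)) := by
  unfold cyc
  simp [ZMod.val_natCast]

theorem cyc_prim (l : List A) (hl : l ≠ []) (hp : ∀ e m, 2 ≤ m → l ≠ wpow e m)
    (d : ZMod l.length) (hd : ∀ k, cyc l hl (k + d) = cyc l hl k) : d = 0 := by
  haveI : NeZero l.length := ⟨by simpa using hl⟩
  by_contra hd0
  have hpos : 0 < l.length := List.length_pos_of_ne_nil hl
  -- integer periods
  have hz : ∀ (z : ℤ) k, cyc l hl (k + z * d) = cyc l hl k := by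
    intro z
    induction z using Int.induction_on with
    | zero => simp
    | succ i ih => intro k; rw [← ih k, ← hd (k + ((i : ℤ) : ZMod l.length) * d)]; congr 1; push_cast; ring
    | pred i ih => intro k; rw [← ih k, ← hd]; congr 1; push_cast; ring
  let g := Nat.gcd d.val l.length
  have hg : ∀ k, cyc l hl (k + (g : ℕ)) = cyc l hl k := by
    intro k
    have h1 := Nat.gcd_eq_gcd_ab d.val l.length
    have h2 : ((g : ℕ) : ZMod l.length) = (Nat.gcdA d.val l.length : ℤ) * d := by
      have := congrArg (Int.cast : ℤ → ZMod l.length) h1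
      push_cast at this
      rw [ZMod.natCast_self, zero_mul, add_zero, ZMod.natCast_zmod_val, mul_comm] at this
      exact this
    rw [h2, hz]
  have hgn : ∀ (m : ℕ) k, cyc l hl (k + (m * g : ℕ)) = cyc l hl k := by
    intro m
    induction m with
    | zero => simp
    | succ m ih => intro k; rw [← ih k, ← hg (k + ((m * g : ℕ) : ZMod l.length))]; congr 1; push_cast; ring
  obtain ⟨m, hm⟩ : g ∣ l.length := Nat.gcd_dvd_right _ _
  have hgpos : 0 < g := Nat.gcd_pos_of_pos_right _ hpos
  have hgle : g ≤ d.val := Nat.gcd_le_left _ (Nat.pos_of_ne_zero (by simpa using hd0))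
  have hdlt : d.val < l.length := ZMod.val_lt d
  have hm2 : 2 ≤ m := by
    by_contra hlt
    have : m = 0 ∨ m = 1 := by omega
    rcases this with rfl | rfl <;> omega
  refine hp (List.ofFn fun i : Fin g => cyc l hl (i : ℕ)) m hm2 ?_
  have hm' : l.length = m * g := by rw [hm, mul_comm]
  have : l = List.ofFn (fun i : Fin (m * g) => cyc l hl (i : ℕ)) := by
    apply List.ext_getElem
    · simp [hm']
    · intro i h1 h2
      simp [cyc_nat, Nat.mod_eq_of_lt h1]
  conv_lhs => rw [this]
  rw [List.ofFn_mul, wpow]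
  congr 1
  rw [← List.ofFn_const]
  congr 1
  funext i
  congr 1
  funext j
  simp only
  rw [← hgn i ((j : ℕ) : ZMod l.length)]
  push_cast
  congr 1
  ring

theorem cyc_len {l l' : List A} (hl : l ≠ []) (hl' : l' ≠ [])
    (hp : ∀ e m, 2 ≤ m → l ≠ wpow e m) (hp' : ∀ e m, 2 ≤ m → l' ≠ wpow e m) (σ σ' : A → A)
    (hσ : ∀ x, σ' (σ x) = x) (u : ZMod l.length → ZMod l.length)
    (hu : Function.Injective u) (ε : ZMod l.length)  (hε : ε * ε = 1)
    (huε : ∀ k d, u (k + d) = u k + ε * d)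
    (hm : ∀ i : ℕ, σ (cyc l hl (u i)) = cyc l' hl' i) : l.length = l'.length := by
  haveI : NeZero l.length := ⟨by simpa using hl⟩
  haveI : NeZero l'.length := ⟨by simpa using hl'⟩
  have hm' : ∀ i : ℕ, cyc l hl (u i) = σ' (cyc l' hl' i) := fun i => by rw [← hm, hσ]
  have hus : Function.Surjective u := Finite.surjective_of_injective hu
  apply Nat.dvd_antisymm
  · rw [← ZMod.natCast_eq_zero_iff]
    have : ε * ((l'.length : ℕ) : ZMod l.length) = 0 := by
      apply cyc_prim l hl hp
      intro k
      obtain ⟨k, rfl⟩ := hus k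
      rw [← huε, ← ZMod.natCast_zmod_val k, ← Nat.cast_add, hm', hm']
      simp
    calc _ = ε * (ε * ((l'.length : ℕ) : ZMod l.length)) := by rw [← mul_assoc, hε, one_mul]
      _ = 0 := by rw [this, mul_zero]
  · rw [← ZMod.natCast_eq_zero_iff]
    apply cyc_prim l' hl' hp'
    intro k
    rw [← ZMod.natCast_zmod_val k, ← Nat.cast_add, ← hm, ← hm]
    simp

theorem cyc_plus {l l' : List A} (hl : l ≠ []) (hl' : l' ≠ [])
    (hp : ∀ e m, 2 ≤ m → l ≠ wpow e m) (hp' : ∀ e m, 2 ≤ m → l' ≠ wpow e m)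
    (k : ZMod l.length) (hm : ∀ i : ℕ, cyc l hl (k + i) = cyc l' hl' i) :
    List.IsRotated l l' := by
  have hlen := cyc_len hl hl' hp hp' id id (fun _ => rfl) (fun i => k + i)
    (add_right_injective k) 1 (by simp) (by intros; ring) hm
  haveI : NeZero l.length := ⟨by simpa using hl⟩
  refine ⟨k.val, ?_⟩
  apply List.ext_getElem
  · simp [hlen]
  · intro i h1 h2
    have := hm i
    rw [cyc_nat l', ← ZMod.natCast_zmod_val k, ← Nat.cast_add, cyc_nat] at this
    simp only [Nat.mod_eq_of_lt h2] at this
    rw [List.getElem_rotate, ← this]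
    congr 2
    exact add_comm _ _

theorem cyc_minus {l l' : List A} (hl : l ≠ []) (hl' : l' ≠ [])
    (hp : ∀ e m, 2 ≤ m → l ≠ wpow e m) (hp' : ∀ e m, 2 ≤ m → l' ≠ wpow e m)
    (τ : A → A) (hτ : ∀ x, τ (τ x) = x)
    (k : ZMod l.length) (hm : ∀ i : ℕ, τ (cyc l hl (k - i)) = cyc l' hl' i) :
    List.IsRotated l' (wordT τ l) := by
  have hlen := cyc_len hl hl' hp hp' τ τ hτ (fun i => k - i)
    (sub_right_injective) (-1) (by simp) (by intros; ring) hm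
  haveI : NeZero l.length := ⟨by simpa using hl⟩
  apply List.IsRotated.symm
  refine ⟨(-1 - k).val, ?_⟩
  apply List.ext_getElem
  · simp [wordT, hlen]
  · intro i h1 h2
    have := hm i
    rw [cyc_nat l'] at this
    simp only [Nat.mod_eq_of_lt h2] at this
    rw [List.getElem_rotate, ← this]
    simp only [wordT, List.getElem_map, List.getElem_reverse]
    congr 1
    have hlt : l.length - 1 - (i + (-1 - k).val) % l.length < l.length := by
      have := List.length_pos_of_ne_nil hl
      omega
    have h3 : k - i = ((l.length - 1 - (i + (-1 - k).val) % l.length : ℕ) : ZMod l.length) := by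
      have := Nat.mod_lt (i + (-1 - k).val) (List.length_pos_of_ne_nil hl)
      rw [Nat.sub_sub, Nat.cast_sub (by omega)]
      push_cast
      simp
      ring
    rw [h3, cyc_nat]
    simp [Nat.mod_eq_of_lt hlt]

theorem cyc_no_sym {V : Type} {h t : A → V} {τ : A → A} {inv : V → V} {n : ℕ} [NeZero n]
    (c : ZMod n → A) (inv_ne : ∀ v, inv v ≠ v) (tau_ne : ∀ x, τ x ≠ x)
    (t_tau : ∀ x, t (τ x) = inv (h x)) (closed : ∀ k, t (c k) = h (c (k + 1)))
    (k : ZMod n) (hm : ∀ i : ℕ, τ (c (k - i)) = c i) : False := by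
  obtain ⟨i, hi⟩ := Nat.even_or_odd' k.val
  have hk : k = (k.val : ZMod n) := (ZMod.natCast_zmod_val k).symm
  have := hm i
  rcases hi with hi | hi
  · rw [hi] at hk
    have h2 : k - i = (i : ZMod n) := by rw [hk]; push_cast; ring
    rw [h2] at this
    exact tau_ne _ this
  · rw [hi] at hk
    have h2 : k - i = (i : ZMod n) + 1 := by rw [hk]; push_cast; ring
    rw [h2] at this
    have h3 := t_tau (c (i + 1))
    rw [this, ← closed] at h3
    exact inv_ne _ h3.symm

theorem cyc_closed {V : Type} {h t : A → V} (l : List A) (hl : l ≠ [])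
    (h1 : l.IsChain (fun x y => t x = h y)) (h2 : h (l.head hl) = t (l.getLast hl))
    (k : ZMod l.length) : t (cyc l hl k) = h (cyc l hl (k + 1)) := by
  haveI : NeZero l.length := ⟨by simpa using hl⟩
  have hlt := ZMod.val_lt k
  rw [← ZMod.natCast_zmod_val k, ← Nat.cast_one, ← Nat.cast_add, cyc_nat, cyc_nat]
  simp only [Nat.mod_eq_of_lt hlt]
  by_cases hk : k.val + 1 < l.length
  · simp only [Nat.mod_eq_of_lt hk]
    exact List.isChain_iff_getElem.1 h1 _ hk
  · have hk' : k.val + 1 = l.length := by omega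
    have hk2 : k.val = l.length - 1 := by omega
    simp only [hk', Nat.mod_self]
    rw [List.head_eq_getElem, List.getLast_eq_getElem] at h2
    rw [h2]
    simp only [hk2]

end Words

section Spec
variable {J : Type} {r : J → ℕ} {c : ∀ j, ZMod (r j) → Q1 ⊕ Q1} {K : Type*} [Field K]

open Classical in
/-- specialization values -/
noncomputable def specW (c : ∀ j, ZMod (r j) → Q1 ⊕ Q1) (T : ℕ) (y : J → Fin T → K) (N : ℕ+)
    (e : Fin N ≃ Option (DynB r T)) (x : (a : Q1) × (Fin N × Fin N)) : K :=
  if (tl x.1, e x.2.2) = dynG (dhd Q0 Q1 hd tl ι) ι r c T (hd x.1, e x.2.1) ∧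
      dynL (dhd Q0 Q1 hd tl ι) Sum.swap ι r c T (hd x.1, e x.2.1) = some (Sum.inl x.1) then
    dynW (dhd Q0 Q1 hd tl ι) r c T y (hd x.1, e x.2.1) else 0

/-- index equivalence -/
def idxE (T : ℕ) (N : ℕ+) (e : Fin N ≃ Option (DynB r T)) :
    ((v : Q0) × Fin ((fun _ : Q0 => N) v)) ≃ Q0 × Option (DynB r T) where
  toFun P := (P.1, e P.2)
  invFun P := ⟨P.1, e.symm P.2⟩
  left_inv P := by simp
  right_inv P := by simp

/-- specialization -/
noncomputable def specφ (F : Type*) [Field F] [Algebra F K] (c : ∀ j, ZMod (r j) → Q1 ⊕ Q1)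
    (T : ℕ) (y : J → Fin T → K) (N : ℕ+) (e : Fin N ≃ Option (DynB r T)) :
    RQ Q0 Q1 hd tl F (fun _ => N) →ₐ[F] K :=
  MvPolynomial.aeval (specW Q0 Q1 hd tl ι c T y N e)

theorem spec_arrow (F : Type*) [Field F] [Algebra F K]
    (W : GoodWords (dhd Q0 Q1 hd tl ι) (dtl Q0 Q1 hd tl ι) Sum.swap ι r c)
    (T : ℕ) (y : J → Fin T → K) (N : ℕ+) (e : Fin N ≃ Option (DynB r T))
    (hn : ∀ v : Q0, (fun _ : Q0 => N) (ι v) = (fun _ : Q0 => N) v)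
    (x : Q1 ⊕ Q1) (P Q : (v : Q0) × Fin ((fun _ : Q0 => N) v)) :
    specφ Q0 Q1 hd tl ι F c T y N e (arrowMat Q0 Q1 hd tl ι F (fun _ => N) hn x P Q) =
      open Classical in
      if idxE Q0 T N e Q = dynG (dhd Q0 Q1 hd tl ι) ι r c T (idxE Q0 T N e P) ∧
        dynL (dhd Q0 Q1 hd tl ι) Sum.swap ι r c T (idxE Q0 T N e P) = some x then
        dynW (dhd Q0 Q1 hd tl ι) r c T y (idxE Q0 T N e P) else 0 := by
  classical
  obtain ⟨v, p⟩ := P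
  obtain ⟨w, q⟩ := Q
  have hht := dyn_ht W T (v, e p) x
  cases x with
  | inl a =>
    simp only [arrowMat, Matrix.of_apply, idxE, Equiv.coe_fn_mk]
    by_cases h1 : v = hd a ∧ w = tl a
    · rw [dif_pos h1]
      obtain ⟨rfl, rfl⟩ := h1
      simp only [specφ, MvPolynomial.aeval_X, specW]
      rfl
    · rw [dif_neg h1, map_zero]
      refine (if_neg ?_).symm
      intro h2
      obtain ⟨h3, h4⟩ := hht h2.2
      rw [← h2.1] at h4
      exact h1 ⟨h3, h4⟩
  | inr a =>
    simp only [arrowMat, Matrix.of_apply, idxE, Equiv.coe_fn_mk]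
    have hfl := dyn_flip_iff W T (v, e p) (w, e q) (Sum.inr a)
    have hfw := dyn_flip W T y (v, e p) (w, e q) (Sum.inr a)
    by_cases h1 : v = ι (tl a) ∧ w = ι (hd a)
    · rw [dif_pos h1]
      obtain ⟨rfl, rfl⟩ := h1
      simp only [specφ, MvPolynomial.aeval_X, specW]
      by_cases h2 : (ι (hd a), e q) = dynG (dhd Q0 Q1 hd tl ι) ι r c T (ι (tl a), e p) ∧
        dynL (dhd Q0 Q1 hd tl ι) Sum.swap ι r c T (ι (tl a), e p) = some (Sum.inr a)
      · refine Eq.trans ?_ (if_pos h2).symm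
        rw [← (hfw h2.1 h2.2).2]
        rw [hfl] at h2
        simp only [W.inv_inv] at h2 ⊢
        exact if_pos h2
      · refine Eq.trans ?_ (if_neg h2).symm
        rw [hfl] at h2
        simp only [W.inv_inv] at h2 ⊢
        exact if_neg h2
    · rw [dif_neg h1, map_zero]
      refine (if_neg ?_).symm
      intro h2
      obtain ⟨h3, h4⟩ := hht h2.2
      rw [← h2.1] at h4
      exact h1 ⟨h3, h4⟩

theorem spec_sigma (F : Type*) [Field F] [Algebra F K] [∀ j, NeZero (r j)]
    (W : GoodWords (dhd Q0 Q1 hd tl ι) (dtl Q0 Q1 hd tl ι) Sum.swap ι r c)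
    (T : ℕ) (y : J → Fin T → K) (N : ℕ+) (e : Fin N ≃ Option (DynB r T))
    (hn : ∀ v : Q0, (fun _ : Q0 => N) (ι v) = (fun _ : Q0 => N) v)
    (j : J) (l : List (Q1 ⊕ Q1)) (hl : l.length = r j)
    (hlc : ∀ i (h : i < l.length), l[i] = c j i)
    (v : Q0) (hv : v = dhd Q0 Q1 hd tl ι (c j 0)) (t : ℕ) (ht : 1 ≤ t) (htT : t ≤ T) :
    specφ Q0 Q1 hd tl ι F c T y N e (msigma t
      (blockAt Q0 Q1 hd tl F (fun _ => N) (pathMat Q0 Q1 hd tl ι F (fun _ => N) hn l) v)) =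
    (∏ s, ((Polynomial.X : Polynomial K) + Polynomial.C (y j s))).coeff (T - t) := by
  classical
  subst hv
  set g := dynG (dhd Q0 Q1 hd tl ι) ι r c T with hg
  set L := dynL (dhd Q0 Q1 hd tl ι) Sum.swap ι r c T with hL
  set φ := specφ Q0 Q1 hd tl ι F c T y N e with hφ
  have hmap : ∀ P Q, φ (pathMat Q0 Q1 hd tl ι F (fun _ => N) hn l P Q) =
      if idxE Q0 T N e Q = g^[l.length] (idxE Q0 T N e P) ∧
        (∀ i (h : i < l.length), L (g^[i] (idxE Q0 T N e P)) = some l[i]) then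
        ∏ i ∈ Finset.range l.length,
          dynW (dhd Q0 Q1 hd tl ι) r c T y (g^[i] (idxE Q0 T N e P)) else 0 := by
    intro P Q
    have h1 := aux_prod (idxE Q0 T N e)
      (φ.toRingHom.mapMatrix ∘ arrowMat Q0 Q1 hd tl ι F (fun _ => N) hn) g L
      (dynW (dhd Q0 Q1 hd tl ι) r c T y)
      (fun x P Q => (spec_arrow Q0 Q1 hd tl ι F W T y N e hn x P Q).trans (by congr)) l P Q
    rw [← List.map_map (f := arrowMat Q0 Q1 hd tl ι F (fun _ => N) hn)
      (g := φ.toRingHom.mapMatrix), ← map_list_prod] at h1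
    refine Eq.trans ?_ (h1.trans (by congr))
    rfl
  obtain ⟨m, hm⟩ := aux_rank g L (fun i : ℕ => c j i) (r j) (Nat.pos_of_ne_zero (NeZero.ne _))
    (by intro i; simp)
  rw [← AlgHom.coe_toRingHom, aux_msigma_map]
  let vv := dhd Q0 Q1 hd tl ι (c j 0)
  have hM : ∀ p q : Fin N, ((blockAt Q0 Q1 hd tl F (fun _ => N)
      (pathMat Q0 Q1 hd tl ι F (fun _ => N) hn l) vv).map φ.toRingHom) p q =
      if (vv, e q) = g^[r j] (vv, e p) ∧
        (∀ i : ℕ, i < r j → L (g^[i] (vv, e p)) = some (c j i)) then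
        ∏ i ∈ Finset.range (r j),
          dynW (dhd Q0 Q1 hd tl ι) r c T y (g^[i] (vv, e p)) else 0 := by
    intro p q
    refine (hmap ⟨vv, p⟩ ⟨vv, q⟩).trans ?_
    have : (∀ i (h : i < l.length), L (g^[i] (idxE Q0 T N e ⟨vv, p⟩)) = some l[i]) ↔
        (∀ i : ℕ, i < r j → L (g^[i] (vv, e p)) = some (c j i)) := by
      constructor
      · intro h i hi
        have hi' : i < l.length := by omega
        have := h i hi'
        rw [hlc i hi'] at this
        exact this
      · intro h i hi
        rw [hlc i hi]
        exact h i (by omega)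
    simp only [this]
    simp only [hl]
    rfl
  refine aux_sigma T t ht htT _ (fun p : Fin N => m (vv, e p))
    (fun s => e.symm (some ⟨j, s, 0⟩)) ?_ (y j) ?_ ?_
  · intro s s' h
    have := e.symm.injective h
    simpa using this
  · intro s
    refine (hM _ _).trans ?_
    rw [if_pos]
    · rw [Equiv.apply_symm_apply]
      exact dyn_wprod T y j s
    · rw [Equiv.apply_symm_apply]
      constructor
      · rw [hg, dynG_plus_iter]
        simp [vv]
      · intro i _
        rw [hg, dynG_plus_iter, hL, dynL_plus, zero_add]
  · intro p q hpq
    change ((blockAt Q0 Q1 hd tl F (fun _ => N)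
      (pathMat Q0 Q1 hd tl ι F (fun _ => N) hn l) vv).map φ.toRingHom) p q ≠ 0 at hpq
    rw [hM] at hpq
    split_ifs at hpq with h1
    · obtain ⟨h1, h2⟩ := h1
      by_cases hfull : ∀ i : ℕ, L (g^[i] (vv, e p)) = some (c j i)
      · left
        obtain ⟨s, hs⟩ := dyn_full W T (vv, e p) j hfull
        have hp : e p = some ⟨j, s, 0⟩ := (Prod.mk.inj hs).2
        refine ⟨?_, s, by simp [← hp]⟩
        rw [hp, hg, dynG_plus_iter] at h1
        have hq : e q = some ⟨j, s, 0⟩ := by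
          have := (Prod.mk.inj h1).2
          simpa using this
        exact e.injective (hp.trans hq.symm)
      · right
        push Not at hfull
        have := hm (vv, e p) h2 hfull
        rw [← h1] at this
        exact this
    · exact absurd rfl hpq

end Spec

/-- **Lemma 6.1.** Over an infinite field of arbitrary characteristic, the ideal
`K(Q,ι)` of free relations for invariants of mixed representations of the quiver `Q`
is zero: if `f ∈ N_σ(Q,ι)` satisfies `Υ_n(f) = 0` for every dimension vector `n` with
`n_{ι(v)} = n_v` for all `v`, then `f = 0`. -/
theorem free_relations_mixed_quiver (F : Type*) [Field F] [Infinite F]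
    (hι2 : ∀ v, ι (ι v) = v) (hιne : ∀ v, ι v ≠ v)
    (f : NsigmaQ Q0 Q1 hd tl ι F)
    (hf : ∀ (n : Q0 → ℕ+) (hn : ∀ v, n (ι v) = n v),
      UpsilonQ Q0 Q1 hd tl ι F n hn f = 0) :
    f = 0 := by

  classical
  by_contra hf0
  obtain ⟨z, hz⟩ : ∃ z, MvPolynomial.eval z f ≠ 0 := by
    by_contra hcon
    push Not at hcon
    exact hf0 (MvPolynomial.funext fun x => by simpa using hcon x)
  let K := AlgebraicClosure F
  let S : Finset (QCls Q0 Q1 hd tl ι) := f.vars.image Prod.snd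
  let J := {q : QCls Q0 Q1 hd tl ι // q ∈ S}
  let T : ℕ := f.vars.sup (fun v => (v.1 : ℕ))
  let l : J → List (Q1 ⊕ Q1) := fun j => (Quot.out j.1).1
  have hl : ∀ j, l j ≠ [] := fun j => (Quot.out j.1).2.1.choose
  let r : J → ℕ := fun j => (l j).length
  haveI hr : ∀ j, NeZero (r j) := fun j => ⟨by simpa [r] using hl j⟩
  let c : ∀ j, ZMod (r j) → Q1 ⊕ Q1 := fun j => cyc (l j) (hl j)
  have hprim : ∀ j e m, 2 ≤ m → l j ≠ wpow e m := fun j => (Quot.out j.1).2.2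
  have hsim : ∀ j j', simRel Sum.swap (l j) (l j') → j = j' := by
    intro j j' h
    apply Subtype.ext
    have := Quot.sound (r := fun a b : PrimPath Q0 Q1 hd tl ι => simRel Sum.swap a.1 b.1)
      (a := Quot.out j.1) (b := Quot.out j'.1) h
    exact (Quot.out_eq _).symm.trans (this.trans (Quot.out_eq _))
  have hclosed : ∀ j k, dtl Q0 Q1 hd tl ι (c j k) = dhd Q0 Q1 hd tl ι (c j (k + 1)) := by
    intro j k
    obtain ⟨h0, h1, h2⟩ := (Quot.out j.1).2.1
    exact cyc_closed (l j) (hl j) h1 h2 k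
  have htt : ∀ x, dtl Q0 Q1 hd tl ι (Sum.swap x) = ι (dhd Q0 Q1 hd tl ι x) := by
    rintro (x | x) <;> simp [dtl, dhd, hι2]
  have W : GoodWords (dhd Q0 Q1 hd tl ι) (dtl Q0 Q1 hd tl ι) Sum.swap ι r c :=
    { inv_inv := hι2
      inv_ne := hιne
      tau_tau := Sum.swap_swap
      h_tau := by rintro (x | x) <;> simp [dtl, dhd, hι2]
      t_tau := htt
      closed := hclosed
      full_plus := by
        intro j j0 k h
        have h1 := cyc_plus (hl j) (hl j0) (hprim j) (hprim j0) k h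
        obtain rfl := hsim j j0 (Or.inl h1)
        have : k = 0 := by
          apply cyc_prim (l j) (hl j) (hprim j)
          intro k'
          have := h k'.val
          rw [ZMod.natCast_zmod_val, add_comm] at this
          exact this
        rw [this]
      full_minus := by
        intro j j0 k h
        have h1 := cyc_minus (hl j) (hl j0) (hprim j) (hprim j0) Sum.swap Sum.swap_swap k h
        obtain rfl := hsim j0 j (Or.inr h1)
        exact cyc_no_sym (c j0) hιne (by rintro (x | x) <;> simp) htt (hclosed j0) k h }
  choose y hy using fun j : J => aux_vieta (K := K) T
    (fun t => algebraMap F K (z (t.toPNat', j.1)))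
  haveI : ∀ j, Fintype (ZMod (r j)) := fun j => ZMod.fintype (r j)
  let N : ℕ+ := ⟨Fintype.card (Option (DynB r T)), Fintype.card_pos⟩
  let e : Fin N ≃ Option (DynB r T) := (Fintype.equivFin (Option (DynB r T))).symm
  have h0 := hf (fun _ => N) (fun _ => rfl)
  have h1 := congrArg (specφ Q0 Q1 hd tl ι F c T y N e) h0
  rw [map_zero, UpsilonQ, ← AlgHom.comp_apply, MvPolynomial.comp_aeval] at h1
  have h2 : algebraMap F K (MvPolynomial.eval z f) = 0 := by
    have h3 : MvPolynomial.eval z f = MvPolynomial.aeval z f := by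
      rw [← MvPolynomial.coe_aeval_eq_eval]; rfl
    rw [← h1, h3, ← MvPolynomial.aeval_algebraMap_apply]
    apply MvPolynomial.eval₂Hom_congr' rfl _ rfl
    rintro ⟨t, q⟩ hv -
    have hq : q ∈ S := Finset.mem_image.2 ⟨_, hv, rfl⟩
    have htT : (t : ℕ) ≤ T := Finset.le_sup (f := fun v : ℕ+ × QCls Q0 Q1 hd tl ι => (v.1 : ℕ)) hv
    let j : J := ⟨q, hq⟩
    have hTN : T ≤ (N : ℕ) := by
      have := Fintype.card_le_of_injective (fun s : Fin T => (some ⟨j, s, 0⟩ : Option (DynB r T)))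
        (by intro s s' h; simpa using h)
      simpa [N] using this
    have hle : (t : ℕ) ≤ (N : ℕ) := htT.trans hTN
    simp only [Function.comp]
    rw [if_pos hle]
    have := spec_sigma Q0 Q1 hd tl ι F W T y N e (fun _ => rfl) j (l j) rfl
      (fun i h => by
        simp only [c]
        rw [cyc_nat]
        simp only [Nat.mod_eq_of_lt h])
      (pathHead Q0 Q1 hd tl ι (Quot.out q))
      (by
        unfold pathHead
        congr 1
        rw [List.head_eq_getElem]
        have := cyc_nat (l j) (hl j) 0
        simp only [Nat.zero_mod, Nat.cast_zero] at this
        exact this.symm)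
      t t.pos htT
    rw [this, hy j t t.pos htT]
    simp [j]
  exact hz ((map_eq_zero _).1 h2)

end MixedQuiver
end
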